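/- Let Σμ = diag(λ_{μ,1},…,λ_{μ,m}) be a diagonal matrix with positive non-increasing diagonal entries, let Σ_x be an m×m positive definite matrix with eigenvalues λ_{x,1} ≥ … ≥ λ_{x,m} > 0, and let π_x = N(0,Σ_x), μ = N(0,Σμ). Then KL(π_x ‖ μ) ≥ (1/2) Σ_{i=1}^{m} Ψ(λ_{x,i} / λ_{μ,i}), where Ψ(x) = x − log(x) − 1. -/

import Mathlib

open MeasureTheory Matrix ENNReal

/-- Density (w.r.t. Lebesgue measure) of the centered Gaussian with covariance `S`. -/
noncomputable def gaussianPdf {ι : Type*} [Fintype ι] [DecidableEq ι]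
    (S : Matrix ι ι ℝ) (x : ι → ℝ) : ℝ≥0∞ :=
  ENNReal.ofReal (Real.exp (-(x ⬝ᵥ (S⁻¹ *ᵥ x)) / 2) /
    Real.sqrt ((2 * Real.pi) ^ (Fintype.card ι) * S.det))

/-- The centered Gaussian measure `N(0, S)` on `ι → ℝ` with covariance matrix `S`. -/
noncomputable def gaussianMeasure {ι : Type*} [Fintype ι] [DecidableEq ι]
    (S : Matrix ι ι ℝ) : Measure (ι → ℝ) :=
  MeasureTheory.volume.withDensity (gaussianPdf S)

/-- Generalized Kullback–Leibler divergence between positive measures: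
`KL(α‖β) = ∫ log (dα/dβ) dα + β(univ) - α(univ)`.
For probability measures this is the usual Kullback–Leibler divergence. -/
noncomputable def KLgen {X : Type*} [MeasurableSpace X] (α β : Measure X) : ℝ :=
  (∫ x, Real.log ((α.rnDeriv β x).toReal) ∂α) + (β Set.univ).toReal - (α Set.univ).toReal

section GaussianMeasure

open ProbabilityTheory

variable {ι : Type*} [Fintype ι] [DecidableEq ι]

lemma measurable_gaussianPdf (S : Matrix ι ι ℝ) : Measurable (gaussianPdf S) := by
  unfold gaussianPdf
  refine ENNReal.measurable_ofReal.comp (Continuous.measurable ?_)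
  fun_prop

lemma gaussianPdf_ne_top (S : Matrix ι ι ℝ) (x : ι → ℝ) : gaussianPdf S x ≠ ∞ :=
  ENNReal.ofReal_ne_top

lemma gaussianPdf_pos {S : Matrix ι ι ℝ} (hS : 0 < S.det) (x : ι → ℝ) :
    0 < gaussianPdf S x := by
  unfold gaussianPdf
  rw [ENNReal.ofReal_pos]
  positivity

lemma log_gaussianPdf {S : Matrix ι ι ℝ} (hS : 0 < S.det) (x : ι → ℝ) :
    Real.log (gaussianPdf S x).toReal = -(x ⬝ᵥ (S⁻¹ *ᵥ x)) / 2 -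
      (Fintype.card ι * Real.log (2 * Real.pi) + Real.log S.det) / 2 := by
  have hpi : (0 : ℝ) < (2 * Real.pi) ^ Fintype.card ι := by positivity
  rw [gaussianPdf, ENNReal.toReal_ofReal (by positivity),
    Real.log_div (Real.exp_pos _).ne' (by positivity), Real.log_exp,
    Real.log_sqrt (by positivity), Real.log_mul hpi.ne' hS.ne', Real.log_pow]

instance sigmaFinite_gaussianMeasure (S : Matrix ι ι ℝ) : SigmaFinite (gaussianMeasure S) :=
  SigmaFinite.withDensity_of_ne_top (ae_of_all _ (gaussianPdf_ne_top S))

lemma gaussianPdf_diagonal {l : ι → ℝ} (hl : ∀ i, 0 < l i) (x : ι → ℝ) :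
    gaussianPdf (diagonal l) x =
      ENNReal.ofReal (∏ i, gaussianPDFReal 0 (l i).toNNReal (x i)) := by
  have hinv : (diagonal l)⁻¹ = diagonal fun i ↦ (l i)⁻¹ := by
    rw [Matrix.inv_eq_right_inv]
    simp [diagonal_mul_diagonal, (hl _).ne']
  rw [gaussianPdf, hinv]
  congr 1
  simp only [gaussianPDFReal, Finset.prod_mul_distrib, ← Real.exp_sum, Finset.prod_inv_distrib,
    Real.coe_toNNReal _ (hl _).le, sub_zero]
  rw [← Real.sqrt_prod _ (fun i _ ↦ by have := hl i; positivity), Finset.prod_mul_distrib,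
    det_diagonal, Finset.prod_const, Finset.card_univ, div_eq_inv_mul]
  congr 2
  simp only [dotProduct, mulVec_diagonal, ← Finset.sum_neg_distrib, Finset.sum_div]
  refine Finset.sum_congr rfl fun i _ ↦ ?_
  have := (hl i).ne'
  field_simp

lemma gaussianMeasure_diagonal {l : ι → ℝ} (hl : ∀ i, 0 < l i) :
    gaussianMeasure (diagonal l) = Measure.pi fun i ↦ gaussianReal 0 (l i).toNNReal := by
  have hl' i : (l i).toNNReal ≠ 0 := by simpa using hl i
  refine (Measure.pi_eq fun s hs ↦ ?_).symm
  rw [gaussianMeasure, withDensity_apply _ (.univ_pi hs), volume_pi, Measure.restrict_pi_pi]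
  simp_rw [gaussianPdf_diagonal hl]
  rw [← ofReal_integral_eq_lintegral_ofReal, integral_fintype_prod_eq_prod,
    ENNReal.ofReal_prod_of_nonneg]
  · simp_rw [gaussianReal_apply_eq_integral _ (hl' _)]
  · exact fun i _ ↦ integral_nonneg fun _ ↦ gaussianPDFReal_nonneg _ _ _
  · exact .fintype_prod fun i ↦ (integrable_gaussianPDFReal _ _).restrict
  · exact ae_of_all _ fun x ↦ Finset.prod_nonneg fun i _ ↦ gaussianPDFReal_nonneg _ _ _

lemma gaussianPdf_conj {U : Matrix ι ι ℝ} (hU : Uᵀ * U = 1) (S : Matrix ι ι ℝ) (x : ι → ℝ) :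
    gaussianPdf (U * S * Uᵀ) (U *ᵥ x) = gaussianPdf S x := by
  have hinv : U⁻¹ = Uᵀ := Matrix.inv_eq_left_inv hU
  have hinv' : Uᵀ⁻¹ = U := Matrix.inv_eq_right_inv hU
  have hdet : (U * S * Uᵀ).det = S.det := by
    rw [det_mul, det_mul, mul_right_comm, ← det_mul, mul_eq_one_comm.mp hU, det_one, one_mul]
  rw [gaussianPdf, gaussianPdf, hdet, Matrix.mul_inv_rev, Matrix.mul_inv_rev, hinv, hinv',
    mulVec_mulVec, Matrix.mul_assoc, Matrix.mul_assoc, hU, Matrix.mul_one, ← mulVec_mulVec,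
    ← vecMul_transpose, ← dotProduct_mulVec, mulVec_mulVec, hU, one_mulVec]

lemma measurePreserving_mulVec_of_transpose_mul_self {U : Matrix ι ι ℝ} (hU : Uᵀ * U = 1) :
    MeasurePreserving (U *ᵥ ·) (volume : Measure (ι → ℝ)) volume := by
  have hdet : U.det * U.det = 1 := by
    simpa using congrArg det hU
  have habs : |U.det⁻¹| = 1 := by
    rw [abs_inv, inv_eq_one, ← sq_eq_sq₀ (abs_nonneg _) zero_le_one, sq_abs, sq, hdet, one_pow]
  refine ⟨by fun_prop, ?_⟩
  have := Real.map_matrix_volume_pi_eq_smul_volume_pi (M := U) (left_ne_zero_of_mul_eq_one hdet)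
  rw [habs, ENNReal.ofReal_one, one_smul] at this
  exact this

lemma gaussianMeasure_conj {U : Matrix ι ι ℝ} (hU : Uᵀ * U = 1) (S : Matrix ι ι ℝ) :
    gaussianMeasure (U * S * Uᵀ) = (gaussianMeasure S).map (U *ᵥ ·) := by
  have hmp := measurePreserving_mulVec_of_transpose_mul_self hU
  ext s hs
  rw [Measure.map_apply hmp.measurable hs, gaussianMeasure, gaussianMeasure,
    withDensity_apply _ hs, withDensity_apply _ (hmp.measurable hs),
    ← hmp.setLIntegral_comp_preimage hs (measurable_gaussianPdf _)]
  simp_rw [gaussianPdf_conj hU]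

/-- Orthogonal diagonalization of a real positive definite matrix. -/
lemma Matrix.PosDef.exists_orthogonal_diagonalization {S : Matrix ι ι ℝ} (hS : S.PosDef) :
    ∃ U : Matrix ι ι ℝ, Uᵀ * U = 1 ∧ S = U * diagonal hS.1.eigenvalues * Uᵀ := by
  refine ⟨hS.1.eigenvectorUnitary, ?_, ?_⟩
  · simpa [star_eq_conjTranspose] using Unitary.coe_star_mul_self hS.1.eigenvectorUnitary
  · simpa [Unitary.conjStarAlgAut_apply, star_eq_conjTranspose, Function.comp_def]
      using hS.1.spectral_theorem

lemma isProbabilityMeasure_gaussianMeasure {S : Matrix ι ι ℝ} (hS : S.PosDef) :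
    IsProbabilityMeasure (gaussianMeasure S) := by
  obtain ⟨U, hU, h⟩ := hS.exists_orthogonal_diagonalization
  rw [h, gaussianMeasure_conj hU, gaussianMeasure_diagonal hS.eigenvalues_pos]
  exact Measure.isProbabilityMeasure_map (by fun_prop)

lemma memLp_eval_pi_gaussianReal {n : Type*} [Fintype n] (v : n → NNReal) (i : n) :
    MemLp (fun x : n → ℝ ↦ x i) 2 (Measure.pi fun i ↦ gaussianReal 0 (v i)) :=
  (memLp_id_gaussianReal' 2 (by simp)).comp_measurePreserving
    (measurePreserving_eval (fun i ↦ gaussianReal 0 (v i)) i)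

lemma integrable_eval_mul_eval_pi_gaussianReal {n : Type*} [Fintype n] (v : n → NNReal)
    (i j : n) :
    Integrable (fun x : n → ℝ ↦ x i * x j) (Measure.pi fun i ↦ gaussianReal 0 (v i)) :=
  (memLp_eval_pi_gaussianReal v i).integrable_mul (memLp_eval_pi_gaussianReal v j)

lemma integral_eval_mul_eval_pi_gaussianReal (v : ι → NNReal) (i j : ι) :
    ∫ x : ι → ℝ, x i * x j ∂(Measure.pi fun i ↦ gaussianReal 0 (v i)) =
      diagonal (fun i ↦ (v i : ℝ)) i j := by
  have hmean (k : ι) : ∫ x : ι → ℝ, x k ∂(Measure.pi fun i ↦ gaussianReal 0 (v i)) = 0 := by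
    rw [integral_comp_eval (μ := fun i ↦ gaussianReal 0 (v i)) (f := fun y ↦ y) (by fun_prop),
      integral_id_gaussianReal]
  rcases eq_or_ne i j with rfl | hij
  · rw [integral_comp_eval (μ := fun i ↦ gaussianReal 0 (v i)) (f := fun y ↦ y * y) (by fun_prop),
      diagonal_apply_eq, ← variance_fun_id_gaussianReal (μ := 0) (v := v i),
      variance_of_integral_eq_zero (by fun_prop) integral_id_gaussianReal]
    simp only [sq]
  · have hind := iIndepFun_pi (μ := fun i ↦ gaussianReal 0 (v i)) (X := fun _ y ↦ y)
      (fun _ ↦ by fun_prop)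
    rw [(hind.indepFun hij).integral_fun_mul_eq_mul_integral
      (measurable_pi_apply i).aestronglyMeasurable (measurable_pi_apply j).aestronglyMeasurable, hmean,
      zero_mul, diagonal_apply_ne _ hij]

lemma integrable_eval_mul_eval_gaussianMeasure {S : Matrix ι ι ℝ} (hS : S.PosDef) (i j : ι) :
    Integrable (fun x ↦ x i * x j) (gaussianMeasure S) := by
  obtain ⟨U, hU, h⟩ := hS.exists_orthogonal_diagonalization
  rw [h, gaussianMeasure_conj hU, gaussianMeasure_diagonal hS.eigenvalues_pos,
    integrable_map_measure (by fun_prop) (by fun_prop)]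
  simp only [Function.comp_def, mulVec, dotProduct, Finset.sum_mul_sum, mul_mul_mul_comm]
  exact integrable_finsetSum _ fun k _ ↦ integrable_finsetSum _ fun k' _ ↦
    (integrable_eval_mul_eval_pi_gaussianReal _ k k').const_mul _

/-- The covariance matrix of `N(0, S)` is `S`. -/
lemma integral_eval_mul_eval_gaussianMeasure {S : Matrix ι ι ℝ} (hS : S.PosDef) (i j : ι) :
    ∫ x, x i * x j ∂gaussianMeasure S = S i j := by
  obtain ⟨U, hU, h⟩ := hS.exists_orthogonal_diagonalization
  have hint := integrable_eval_mul_eval_pi_gaussianReal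
    (fun i ↦ (hS.1.eigenvalues i).toNNReal)
  conv_lhs => rw [h, gaussianMeasure_conj hU, gaussianMeasure_diagonal hS.eigenvalues_pos,
    integral_map (by fun_prop) (by fun_prop)]
  conv_rhs => rw [h]
  simp only [mulVec, dotProduct, Finset.sum_mul_sum, mul_mul_mul_comm]
  rw [integral_finsetSum _ fun k _ ↦ integrable_finsetSum _ fun k' _ ↦ (hint k k').const_mul _]
  simp_rw [integral_finsetSum _ fun k' _ ↦ (hint _ k').const_mul _, integral_const_mul,
    integral_eval_mul_eval_pi_gaussianReal, Real.coe_toNNReal _ (hS.eigenvalues_pos _).le]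
  simp [Matrix.mul_apply, diagonal_apply, mul_right_comm]

lemma dotProduct_mulVec_eq_sum {n : Type*} [Fintype n] (A : Matrix n n ℝ) (x : n → ℝ) :
    x ⬝ᵥ (A *ᵥ x) = ∑ i, ∑ j, A i j * (x j * x i) := by
  simp only [dotProduct, mulVec, Finset.mul_sum]
  exact Finset.sum_congr rfl fun i _ ↦ Finset.sum_congr rfl fun j _ ↦ by ring

lemma integrable_quadraticForm_gaussianMeasure {S : Matrix ι ι ℝ} (hS : S.PosDef)
    (A : Matrix ι ι ℝ) : Integrable (fun x ↦ x ⬝ᵥ (A *ᵥ x)) (gaussianMeasure S) := by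
  simp_rw [dotProduct_mulVec_eq_sum]
  exact integrable_finsetSum _ fun i _ ↦ integrable_finsetSum _ fun j _ ↦
    (integrable_eval_mul_eval_gaussianMeasure hS j i).const_mul _

lemma integral_quadraticForm_gaussianMeasure {S : Matrix ι ι ℝ} (hS : S.PosDef)
    (A : Matrix ι ι ℝ) : ∫ x, x ⬝ᵥ (A *ᵥ x) ∂gaussianMeasure S = (A * S).trace := by
  have hint := integrable_eval_mul_eval_gaussianMeasure hS
  simp_rw [dotProduct_mulVec_eq_sum]
  rw [integral_finsetSum _ fun i _ ↦ integrable_finsetSum _ fun j _ ↦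
    (hint j i).const_mul (A i j)]
  simp_rw [integral_finsetSum _ fun j _ ↦ (hint j _).const_mul (A _ j), integral_const_mul,
    integral_eval_mul_eval_gaussianMeasure hS]
  simp [Matrix.trace, Matrix.mul_apply]

/-- Closed form of the Kullback-Leibler divergence between centered Gaussian measures. -/
lemma KLgen_gaussianMeasure {S M : Matrix ι ι ℝ} (hS : S.PosDef) (hM : M.PosDef) :
    KLgen (gaussianMeasure S) (gaussianMeasure M) =
      ((M⁻¹ * S).trace - Fintype.card ι - Real.log S.det + Real.log M.det) / 2 := by
  have := isProbabilityMeasure_gaussianMeasure hS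
  have := isProbabilityMeasure_gaussianMeasure hM
  have hrn : (gaussianMeasure S).rnDeriv (gaussianMeasure M) =ᵐ[volume]
      fun x ↦ (gaussianPdf M x)⁻¹ * (gaussianMeasure S).rnDeriv volume x :=
    Measure.rnDeriv_withDensity_right _ _ (measurable_gaussianPdf M).aemeasurable
      (ae_of_all _ fun x ↦ (gaussianPdf_pos hM.det_pos x).ne')
      (ae_of_all _ (gaussianPdf_ne_top M))
  have hlog : (fun x ↦ Real.log ((gaussianMeasure S).rnDeriv (gaussianMeasure M) x).toReal)
      =ᵐ[gaussianMeasure S] fun x ↦ (x ⬝ᵥ (M⁻¹ *ᵥ x) - x ⬝ᵥ (S⁻¹ *ᵥ x)) / 2 +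
        (Real.log M.det - Real.log S.det) / 2 := by
    refine (withDensity_absolutelyContinuous volume (gaussianPdf S)).ae_le ?_
    filter_upwards [hrn, Measure.rnDeriv_withDensity volume (measurable_gaussianPdf S)]
      with x hx hx'
    rw [hx, gaussianMeasure, hx', ENNReal.toReal_mul, ENNReal.toReal_inv, Real.log_mul, Real.log_inv,
      log_gaussianPdf hM.det_pos, log_gaussianPdf hS.det_pos]
    · ring
    · exact inv_ne_zero (ENNReal.toReal_pos (gaussianPdf_pos hM.det_pos x).ne'
        (gaussianPdf_ne_top M x)).ne'
    · exact (ENNReal.toReal_pos (gaussianPdf_pos hS.det_pos x).ne' (gaussianPdf_ne_top S x)).ne'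
  have hiM := integrable_quadraticForm_gaussianMeasure hS M⁻¹
  have hiS := integrable_quadraticForm_gaussianMeasure hS S⁻¹
  have hi : Integrable (fun x ↦ (x ⬝ᵥ (M⁻¹ *ᵥ x) - x ⬝ᵥ (S⁻¹ *ᵥ x)) / 2) (gaussianMeasure S) :=
    (hiM.sub hiS).div_const 2
  rw [KLgen, integral_congr_ae hlog, integral_add hi (integrable_const _), integral_div, integral_sub hiM hiS,
    integral_quadraticForm_gaussianMeasure hS, integral_quadraticForm_gaussianMeasure hS,
    Matrix.nonsing_inv_mul _ hS.det_pos.ne'.isUnit]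
  simp
  ring

/-- A bilinear pairing against a doubly stochastic matrix is at least the oppositely ordered
pairing. -/
lemma sum_mul_le_sum_doublyStochastic {W : Matrix ι ι ℝ} (hW : W ∈ doublyStochastic ℝ ι)
    {a b : ι → ℝ} (hab : Antivary a b) (σ : Equiv.Perm ι) :
    ∑ i, a i * b i ≤ ∑ i, a i * ∑ j, W i j * b (σ j) := by
  obtain ⟨w, hw0, hw1, rfl⟩ := exists_eq_sum_perm_of_mem_doublyStochastic hW
  have hperm (τ : Equiv.Perm ι) : ∑ i, a i * b i ≤ ∑ i, a i * b (σ (τ i)) :=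
    hab.sum_mul_le_sum_mul_comp_perm (σ := τ.trans σ)
  calc ∑ i, a i * b i = ∑ τ, w τ * ∑ i, a i * b i := by rw [← Finset.sum_mul, hw1, one_mul]
    _ ≤ ∑ τ, w τ * ∑ i, a i * b (σ (τ i)) :=
      Finset.sum_le_sum fun τ _ ↦ mul_le_mul_of_nonneg_left (hperm τ) (hw0 τ)
    _ = ∑ i, a i * ∑ τ, w τ * b (σ (τ i)) := by
      simp_rw [Finset.mul_sum]
      rw [Finset.sum_comm]
      exact Finset.sum_congr rfl fun i _ ↦ Finset.sum_congr rfl fun τ _ ↦ by ring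
    _ = _ := by
      refine Finset.sum_congr rfl fun i _ ↦ congrArg _ ?_
      simp_rw [Matrix.sum_apply, Finset.sum_mul]
      rw [Finset.sum_comm]
      refine Finset.sum_congr rfl fun τ _ ↦ ?_
      simp [Equiv.Perm.permMatrix, PEquiv.toMatrix_apply]

lemma sq_mem_doublyStochastic {U : Matrix ι ι ℝ} (hU : Uᵀ * U = 1) :
    Matrix.of (fun i j ↦ U i j ^ 2) ∈ doublyStochastic ℝ ι := by
  rw [mem_doublyStochastic_iff_sum]
  have hU' : U * Uᵀ = 1 := mul_eq_one_comm.mp hU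
  refine ⟨fun i j ↦ sq_nonneg _, fun i ↦ ?_, fun j ↦ ?_⟩
  · simpa [Matrix.mul_apply, sq] using congrFun (congrFun hU' i) i
  · simpa [Matrix.mul_apply, sq] using congrFun (congrFun hU j) j

end GaussianMeasure

/-- if `Sμ = diag(lμ)` has positive non-increasing diagonal entries and `Sx` is
positive definite with eigenvalues `lx` listed in non-increasing order, then
`KL(N(0,Sx) ‖ N(0,Sμ)) ≥ (1/2) ∑ Ψ(lx i / lμ i)` with `Ψ(x) = x - log x - 1`. -/
theorem kl_gaussian_ge_sum_psi
    (m : ℕ) (lμ : Fin m → ℝ)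
    (hlμpos : ∀ i, 0 < lμ i)
    (hlμmono : ∀ i j : Fin m, i ≤ j → lμ j ≤ lμ i)
    (Sx : Matrix (Fin m) (Fin m) ℝ) (hSx : Sx.PosDef)
    (lx : Fin m → ℝ)
    (hlxpos : ∀ i, 0 < lx i)
    (hlxmono : ∀ i j : Fin m, i ≤ j → lx j ≤ lx i)
    (hlx : ∃ σ : Equiv.Perm (Fin m), lx = hSx.1.eigenvalues ∘ σ) :
    KLgen (gaussianMeasure Sx) (gaussianMeasure (Matrix.diagonal lμ))
      ≥ (1 / 2) * ∑ i : Fin m, (lx i / lμ i - Real.log (lx i / lμ i) - 1) := by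
  obtain ⟨σ, hσ⟩ := hlx
  obtain ⟨U, hU, h⟩ := hSx.exists_orthogonal_diagonalization
  have hM : (diagonal lμ).PosDef := PosDef.diagonal hlμpos
  have hinv : (diagonal lμ)⁻¹ = diagonal fun i ↦ (lμ i)⁻¹ := by
    rw [Matrix.inv_eq_right_inv]
    simp [diagonal_mul_diagonal, (hlμpos _).ne']
  have hdet : Real.log Sx.det = ∑ i, Real.log (lx i) := by
    have hprod : Sx.det = ∏ i, lx i := by
      rw [hSx.1.det_eq_prod_eigenvalues, hσ]
      exact (Equiv.prod_comp σ hSx.1.eigenvalues).symm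
    rw [hprod, Real.log_prod fun i _ ↦ (hlxpos i).ne']
  have hdiag (i : Fin m) : Sx i i = ∑ j, U i j ^ 2 * lx (σ.symm j) := by
    conv_lhs => rw [h]
    simp only [Matrix.mul_apply, diagonal_apply, transpose_apply, hσ, Function.comp_apply,
      Equiv.apply_symm_apply, mul_ite, mul_zero, Finset.sum_ite_eq', Finset.mem_univ, if_true]
    exact Finset.sum_congr rfl fun j _ ↦ by ring
  have hanti : Antivary (fun i ↦ (lμ i)⁻¹) lx :=
    Monotone.antivary (fun i j hij ↦ inv_anti₀ (hlμpos j) (hlμmono i j hij))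
      fun i j hij ↦ hlxmono i j hij
  have htrace : ∑ i, lx i / lμ i ≤ ((diagonal lμ)⁻¹ * Sx).trace := by
    simpa [Matrix.trace, hinv, hdiag, div_eq_inv_mul] using
      sum_mul_le_sum_doublyStochastic (sq_mem_doublyStochastic hU) hanti σ.symm
  rw [KLgen_gaussianMeasure hSx hM, hdet, det_diagonal,
    Real.log_prod fun i _ ↦ (hlμpos i).ne']
  simp_rw [Real.log_div (hlxpos _).ne' (hlμpos _).ne', Finset.sum_sub_distrib]
  simp only [Finset.sum_const, Finset.card_univ, nsmul_eq_mul, mul_one]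
  linarith
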